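/- (Lemma 2.2, part 1: compact embedding under (h3)) Assume (h1), (h2) and (h3), and let q ∈ (2, 2*_α). If {u_n} is a sequence in X with sup_n ‖u_n‖ < ∞ which converges weakly in X to some u ∈ X, then ∫_{ℝ^N} K(x)|u_n(x) − u(x)|^q dx → 0 as n → ∞. -/

import Mathlib

open MeasureTheory Filter

noncomputable section

namespace ZeroMass

/-- The ambient Euclidean space `ℝ^N`. -/
abbrev EN (N : ℕ) := EuclideanSpace ℝ (Fin N)

/-- The critical fractional Sobolev exponent `2*_α = 2N/(N-2α)`. -/
def critExp (N : ℕ) (α : ℝ) : ℝ := 2 * N / (N - 2 * α)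

/-- The square of the Gagliardo seminorm `[u]²`. -/
def gagSq (N : ℕ) (α : ℝ) (u : EN N → ℝ) : ENNReal :=
  ∫⁻ p : EN N × EN N, ENNReal.ofReal ((u p.1 - u p.2) ^ 2 / ‖p.1 - p.2‖ ^ ((N : ℝ) + 2 * α))

/-- The square of the full norm `‖u‖² = [u]² + ∫ V u²`. -/
def normSq {N : ℕ} (α : ℝ) (V : EN N → ℝ) (u : EN N → ℝ) : ENNReal :=
  gagSq N α u + ∫⁻ x, ENNReal.ofReal (V x * u x ^ 2)

/-- Membership in the space `X`. -/
def memX {N : ℕ} (α : ℝ) (V : EN N → ℝ) (u : EN N → ℝ) : Prop :=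
  Measurable u ∧ normSq α V u < ⊤

/-- The norm of `X`, i.e. `‖u‖ = ([u]² + ∫ V u²)^{1/2}`. -/
def Xnorm {N : ℕ} (α : ℝ) (V : EN N → ℝ) (u : EN N → ℝ) : ℝ :=
  ((normSq α V u).toReal) ^ (1 / 2 : ℝ)

/-- The primitive `F(t) = ∫₀ᵗ f(τ) dτ`. -/
def prim (f : ℝ → ℝ) (t : ℝ) : ℝ := ∫ τ in (0 : ℝ)..t, f τ

/-- The energy functional `J`. -/
def Jfun {N : ℕ} (α : ℝ) (V K : EN N → ℝ) (f : ℝ → ℝ) (u : EN N → ℝ) : ℝ :=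
  (1 / 2) * (normSq α V u).toReal - ∫ x, K x * prim f (u x)

/-- The pairing `⟨J'(u), φ⟩`. -/
def Jd {N : ℕ} (α : ℝ) (V K : EN N → ℝ) (f : ℝ → ℝ) (u φ : EN N → ℝ) : ℝ :=
  (∫ p : EN N × EN N, (u p.1 - u p.2) * (φ p.1 - φ p.2) / ‖p.1 - p.2‖ ^ ((N : ℝ) + 2 * α))
    + (∫ x, V x * u x * φ x) - ∫ x, K x * f (u x) * φ x

/-- Positive part `u⁺ = max(u, 0)`. -/
def uplus {N : ℕ} (u : EN N → ℝ) : EN N → ℝ := fun x => max (u x) 0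

/-- Negative part `u⁻ = min(u, 0)`. -/
def uminus {N : ℕ} (u : EN N → ℝ) : EN N → ℝ := fun x => min (u x) 0

/-- `u` is not almost everywhere zero. -/
def NotAEZero {N : ℕ} (u : EN N → ℝ) : Prop :=
  ¬ (u =ᵐ[(volume : Measure (EN N))] (0 : EN N → ℝ))

/-- Hypothesis (h1): `V, K > 0` everywhere and `K` bounded. -/
def H1 {N : ℕ} (V K : EN N → ℝ) : Prop :=
  (∀ x, 0 < V x) ∧ (∀ x, 0 < K x) ∧ ∃ C : ℝ, ∀ x, K x ≤ C

/-- Hypothesis (h2): uniform vanishing of `∫_{A_n ∩ {|x| ≥ r}} K`. -/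
def H2 {N : ℕ} (K : EN N → ℝ) : Prop :=
  ∀ (A : ℕ → Set (EN N)) (R : ℝ), 0 < R → (∀ n, MeasurableSet (A n)) →
    (∀ n, volume (A n) ≤ ENNReal.ofReal R) →
    ∀ ε : ℝ, 0 < ε → ∃ r₀ : ℝ, ∀ r : ℝ, r₀ ≤ r → ∀ n,
      (∫⁻ x in A n ∩ {x : EN N | r ≤ ‖x‖}, ENNReal.ofReal (K x)) ≤ ENNReal.ofReal ε

/-- Hypothesis (h3): `K/V` is bounded. -/
def H3 {N : ℕ} (V K : EN N → ℝ) : Prop := ∃ C : ℝ, ∀ x, K x / V x ≤ C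

/-- Hypothesis (h4) with exponent `m`. -/
def H4 {N : ℕ} (α : ℝ) (V K : EN N → ℝ) (m : ℝ) : Prop :=
  2 < m ∧ m < critExp N α ∧
    Tendsto (fun x : EN N => K x / V x ^ ((critExp N α - m) / (critExp N α - 2)))
      (comap (fun x : EN N => ‖x‖) atTop) (nhds 0)

/-- Hypothesis (f1): `f(t)/|t| → 0` as `t → 0`. -/
def Cf1 (f : ℝ → ℝ) : Prop :=
  Tendsto (fun t : ℝ => f t / |t|) (nhdsWithin 0 {(0 : ℝ)}ᶜ) (nhds 0)

/-- Hypothesis (f̃1): `limsup_{t→0} f(t)/|t|^{m-1} < ∞`. -/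
def Cf1' (f : ℝ → ℝ) (m : ℝ) : Prop :=
  ∃ C : ℝ, ∀ᶠ t in nhdsWithin (0 : ℝ) {(0 : ℝ)}ᶜ, f t / |t| ^ (m - 1) ≤ C

/-- Hypothesis (f2) with exponent `p`: `f(t)/|t|^{p-1} → 0` as `|t| → ∞`. -/
def Cf2 (f : ℝ → ℝ) (p : ℝ) : Prop :=
  Tendsto (fun t : ℝ => f t / |t| ^ (p - 1)) (comap (fun t : ℝ => |t|) atTop) (nhds 0)

/-- Hypothesis (f3): `F(t)/t² → +∞` as `|t| → ∞`. -/
def Cf3 (f : ℝ → ℝ) : Prop :=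
  Tendsto (fun t : ℝ => prim f t / t ^ 2) (comap (fun t : ℝ => |t|) atTop) atTop

/-- Hypothesis (f4): `t ↦ f(t)/|t|` is strictly increasing on `ℝ \ {0}`. -/
def Cf4 (f : ℝ → ℝ) : Prop :=
  ∀ s t : ℝ, s ≠ 0 → t ≠ 0 → s < t → f s / |s| < f t / |t|

/-- Nehari manifold membership, formulated with the pairing `⟨J'(u), u⟩ = 0`. -/
def memNehari {N : ℕ} (α : ℝ) (V K : EN N → ℝ) (f : ℝ → ℝ) (u : EN N → ℝ) : Prop :=
  memX α V u ∧ NotAEZero u ∧ Jd α V K f u u = 0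

/-- Nehari manifold membership, formulated as `‖u‖² = ∫ K f(u) u`. -/
def memNehari2 {N : ℕ} (α : ℝ) (V K : EN N → ℝ) (f : ℝ → ℝ) (u : EN N → ℝ) : Prop :=
  memX α V u ∧ NotAEZero u ∧ (normSq α V u).toReal = ∫ x, K x * f (u x) * u x

/-- Nodal (sign-changing) Nehari set membership. -/
def memM {N : ℕ} (α : ℝ) (V K : EN N → ℝ) (f : ℝ → ℝ) (u : EN N → ℝ) : Prop :=
  memNehari α V K f u ∧ NotAEZero (uplus u) ∧ NotAEZero (uminus u) ∧
    Jd α V K f u (uplus u) = 0 ∧ Jd α V K f u (uminus u) = 0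

/-- Weak convergence in `X` of the sequence `u` to `w`. -/
def weakConv {N : ℕ} (α : ℝ) (V : EN N → ℝ) (u : ℕ → EN N → ℝ) (w : EN N → ℝ) : Prop :=
  ∀ v : EN N → ℝ, memX α V v →
    Tendsto (fun n =>
      (∫ p : EN N × EN N,
        ((u n p.1 - w p.1) - (u n p.2 - w p.2)) * (v p.1 - v p.2)
          / ‖p.1 - p.2‖ ^ ((N : ℝ) + 2 * α))
      + ∫ x, V x * (u n x - w x) * v x) atTop (nhds 0)

end ZeroMass

namespace ZeroMass

open Metric Set

variable {N : ℕ} {α : ℝ} {V K : EN N → ℝ}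

/-- The inner integral `∫ |f(x) - f(y)|² / |x - y|^{N+2α} dy` of the Gagliardo seminorm. -/
def gagDensity (N : ℕ) (α : ℝ) (f : EN N → ℝ) (x : EN N) : ENNReal :=
  ∫⁻ y : EN N, ENNReal.ofReal ((f x - f y) ^ 2 / ‖x - y‖ ^ ((N : ℝ) + 2 * α))

lemma measurable_gag_integrand {f : EN N → ℝ} (hf : Measurable f) :
    Measurable (fun p : EN N × EN N =>
      ENNReal.ofReal ((f p.1 - f p.2) ^ 2 / ‖p.1 - p.2‖ ^ ((N : ℝ) + 2 * α))) := by
  fun_prop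

lemma lintegral_gagDensity {f : EN N → ℝ} (hf : Measurable f) :
    ∫⁻ x, gagDensity N α f x = gagSq N α f := by
  unfold gagSq gagDensity
  rw [Measure.volume_eq_prod, lintegral_prod _ (measurable_gag_integrand hf).aemeasurable]

lemma measurable_gagDensity {f : EN N → ℝ} (hf : Measurable f) :
    Measurable (gagDensity N α f) :=
  (measurable_gag_integrand hf).lintegral_prod_right'

lemma mul_volume_le_gagSq {f : EN N → ℝ} (hf : Measurable f) {S : Set (EN N)} {c : ENNReal}
    (hS : ∀ x ∈ S, c ≤ gagDensity N α f x) : c * volume S ≤ gagSq N α f := by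
  rw [← lintegral_gagDensity hf]
  refine le_trans ?_ (mul_meas_ge_le_lintegral (measurable_gagDensity hf) c)
  gcongr
  exact hS

lemma volume_le_of_le_gagDensity {f : EN N → ℝ} (hf : Measurable f) {M c : ℝ} (hc : 0 < c)
    (hM : gagSq N α f ≤ ENNReal.ofReal M) {S : Set (EN N)}
    (hS : ∀ x ∈ S, ENNReal.ofReal c ≤ gagDensity N α f x) :
    volume S ≤ ENNReal.ofReal (M / c) := by
  rw [ENNReal.ofReal_div_of_pos hc, ENNReal.le_div_iff_mul_le (by simp [hc]) (by simp), mul_comm]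
  exact (mul_volume_le_gagSq hf hS).trans hM

lemma setLIntegral_sq_le_gagDensity (hα : 0 < α) {f : EN N → ℝ} {x : EN N} {F : Set (EN N)}
    (hF : MeasurableSet F) {d : ℝ} (hFd : ∀ y ∈ F, ‖x - y‖ ≤ d) :
    ∫⁻ y in F, ENNReal.ofReal ((f x - f y) ^ 2 / d ^ ((N : ℝ) + 2 * α))
      ≤ gagDensity N α f x := by
  refine le_trans (setLIntegral_mono' hF fun y hy => ?_) (setLIntegral_le_lintegral F _)
  rcases eq_or_ne x y with rfl | hxy
  · simp
  · have : 0 < ‖x - y‖ := norm_pos_iff.2 (sub_ne_zero.2 hxy)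
    have := hFd y hy
    gcongr

/-- If every point of `S` sees a set of measure at least `m` within distance `d` on which `f`
differs by at least `c`, then the Gagliardo seminorm controls the measure of `S`. -/
lemma volume_le_of_oscillation (hα : 0 < α) {f : EN N → ℝ} (hf : Measurable f) {M : ℝ}
    (hM : gagSq N α f ≤ ENNReal.ofReal M) {S : Set (EN N)} {c d m : ℝ} (hc : 0 < c) (hd : 0 < d)
    (hm : 0 < m)
    (hS : ∀ x ∈ S, ∃ F, MeasurableSet F ∧ ENNReal.ofReal m ≤ volume F ∧
      ∀ y ∈ F, c ≤ |f x - f y| ∧ ‖x - y‖ ≤ d) :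
    volume S ≤ ENNReal.ofReal (M / (c ^ 2 / d ^ ((N : ℝ) + 2 * α) * m)) := by
  refine volume_le_of_le_gagDensity (α := α) hf (by positivity) hM fun x hx => ?_
  obtain ⟨F, hF, hmF, hFy⟩ := hS x hx
  refine le_trans ?_ (setLIntegral_sq_le_gagDensity hα hF fun y hy => (hFy y hy).2)
  rw [ENNReal.ofReal_mul (by positivity)]
  calc _ ≤ ENNReal.ofReal (c ^ 2 / d ^ ((N : ℝ) + 2 * α)) * volume F := by gcongr
    _ = ∫⁻ y in F, ENNReal.ofReal (c ^ 2 / d ^ ((N : ℝ) + 2 * α)) := by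
      rw [setLIntegral_const]
    _ ≤ _ := by
      refine setLIntegral_mono' hF fun y hy => ?_
      rw [← sq_abs (f x - f y)]
      have := (hFy y hy).1
      gcongr

/-- The volume of the unit ball of `ℝ^N`. -/
def unitBallVol (N : ℕ) : ℝ := volume.real (ball (0 : EN N) 1)

lemma unitBallVol_pos : 0 < unitBallVol N :=
  ENNReal.toReal_pos (measure_ball_pos _ _ one_pos).ne' measure_ball_lt_top.ne

lemma volume_ball_eq (x : EN N) {r : ℝ} (hr : 0 < r) :
    volume (ball x r) = ENNReal.ofReal (unitBallVol N * r ^ N) := by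
  rw [Measure.addHaar_ball_of_pos _ _ hr, mul_comm, ENNReal.ofReal_mul unitBallVol_pos.le, unitBallVol,
    ofReal_measureReal measure_ball_lt_top.ne]
  simp

lemma volumeReal_ball_eq (x : EN N) {r : ℝ} (hr : 0 < r) :
    volume.real (ball x r) = unitBallVol N * r ^ N := by
  rw [measureReal_def, volume_ball_eq x hr, ENNReal.toReal_ofReal]
  have := unitBallVol_pos (N := N)
  positivity

lemma measurableSet_superlevel {f : EN N → ℝ} (hf : Measurable f) (t : ℝ) :
    MeasurableSet {x | t < |f x|} :=
  measurableSet_lt measurable_const hf.abs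

/-- Iterating a superlinear decay relation between dyadic levels. -/
lemma le_mul_rpow_of_dyadic_decay {a : ℝ → ℝ} {A M θ : ℝ} (ha0 : ∀ s, 0 < s → 0 ≤ a s)
    (haA : ∀ s, 0 < s → a s ≤ A) (hθ0 : 0 < θ) (hθ1 : θ < 1)
    (hstep : ∀ s, 0 < s → a (2 * s) ≤ M * s ^ (-2 : ℝ) * a s ^ θ) {s : ℝ} (hs : 0 < s) :
    a s ≤ (max 1 (2 ^ (2 / (1 - θ)) * M)) ^ (1 / (1 - θ)) * s ^ (-(2 / (1 - θ))) := by
  set p : ℝ := 2 / (1 - θ) with hp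
  set M' : ℝ := max 1 (2 ^ p * M) with hM'
  set B : ℝ := M' ^ (1 / (1 - θ)) with hB
  have hθ' : 0 < 1 - θ := by linarith
  have hp0 : 0 < p := by positivity
  have hM'1 : 1 ≤ M' := le_max_left _ _
  have hB1 : 1 ≤ B := Real.one_le_rpow hM'1 (by positivity)
  have hB0 : 0 < B := by linarith
  have hMB : M' * B ^ θ = B := by
    have h1 : B ^ (1 - θ) = M' := by
      rw [hB, ← Real.rpow_mul (by linarith), one_div_mul_cancel hθ'.ne', Real.rpow_one]
    nth_rewrite 1 [← h1]
    rw [← Real.rpow_add hB0]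
    simp
  have hpe : p - 2 - p * θ = 0 := by
    rw [hp]; field_simp; ring
  have step : ∀ s, 0 < s → s ^ p * a s ≤ B → (2 * s) ^ p * a (2 * s) ≤ B := by
    intro s hs h
    have has := ha0 s hs
    calc (2 * s) ^ p * a (2 * s) ≤ (2 * s) ^ p * (M * s ^ (-2 : ℝ) * a s ^ θ) := by
          gcongr; exact hstep s hs
      _ = (2 ^ p * M) * (s ^ p * a s) ^ θ := by
          rw [Real.mul_rpow (by norm_num) hs.le, Real.mul_rpow (by positivity) has,
            ← Real.rpow_mul hs.le]
          have : s ^ p * s ^ (-2 : ℝ) = s ^ (p * θ) := by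
            rw [← Real.rpow_add hs]; congr 1; linarith
          rw [← this]; ring
      _ ≤ M' * B ^ θ := by
          have h1 : 2 ^ p * M ≤ M' := le_max_right _ _
          have : 0 ≤ s ^ p * a s := by positivity
          gcongr
      _ = B := hMB
  have iter : ∀ k : ℕ, ∀ s, 0 < s → s ^ p * a s ≤ B →
      (2 ^ k * s) ^ p * a (2 ^ k * s) ≤ B := by
    intro k
    induction k with
    | zero => intro s _ h; simpa using h
    | succ k ih =>
      intro s hs h
      have := step _ (by positivity) (ih s hs h)
      rwa [← mul_assoc, ← pow_succ'] at this
  have hlim : Tendsto (fun k : ℕ => (s * (1 / 2) ^ k) ^ p * A) atTop (nhds 0) := by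
    have h1 : Tendsto (fun k : ℕ => s * (1 / 2 : ℝ) ^ k) atTop (nhds (s * 0)) :=
      (tendsto_pow_atTop_nhds_zero_of_lt_one (by norm_num) (by norm_num)).const_mul s
    rw [mul_zero] at h1
    have h2 := ((Real.continuousAt_rpow_const 0 p (Or.inr hp0.le)).tendsto.comp h1).mul_const A
    simpa [Real.zero_rpow hp0.ne', Function.comp_def] using h2
  obtain ⟨k, hk⟩ := (hlim.eventually (ge_mem_nhds hB0)).exists
  have hsk : 0 < s * (1 / 2) ^ k := by positivity
  have h := iter k (s * (1 / 2) ^ k) hsk (le_trans (by gcongr; exact haA _ hsk) hk)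
  have e : 2 ^ k * (s * (1 / 2) ^ k) = s := by
    rw [mul_left_comm, ← mul_pow]; norm_num
  rw [e] at h
  rw [Real.rpow_neg hs.le, ← div_eq_mul_inv, le_div_iff₀ (by positivity)]
  linarith

/-- Level set form of the fractional Sobolev inequality inside a ball. -/
lemma volumeReal_superlevel_decay (hα : 0 < α) (hN : 0 < N) {f : EN N → ℝ} (hf : Measurable f)
    {M : ℝ} (hM0 : 0 ≤ M) (hM : gagSq N α f ≤ ENNReal.ofReal M) {r t s : ℝ} (hr : 0 < r)
    (hs : 0 < s)
    (hd : volume.real ({x | t < |f x|} ∩ ball 0 r) ≤ unitBallVol N * r ^ N / 2 ^ (N + 1)) :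
    volume.real ({x | t + 2 * s < |f x|} ∩ ball 0 r) ≤
      (M * (2 * (2 / unitBallVol N) ^ (1 / N : ℝ)) ^ ((N : ℝ) + 2 * α)) * s ^ (-2 : ℝ) *
        volume.real ({x | t + s < |f x|} ∩ ball 0 r) ^ (2 * α / N) := by
  have hω := unitBallVol_pos (N := N)
  have hNR : (0 : ℝ) < N := by exact_mod_cast hN
  have hfin : ∀ t, volume ({x | t < |f x|} ∩ ball (0 : EN N) r) ≠ ⊤ := fun t =>
    measure_ne_top_of_subset inter_subset_right measure_ball_lt_top.ne
  have hmono : ∀ {t t' : ℝ}, t ≤ t' → volume.real ({x | t' < |f x|} ∩ ball (0 : EN N) r) ≤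
      volume.real ({x | t < |f x|} ∩ ball (0 : EN N) r) := fun h =>
    measureReal_mono (inter_subset_inter_left _ fun x hx => lt_of_le_of_lt h hx) (hfin _)
  set A : Set (EN N) := {x | t + s < |f x|} ∩ ball 0 r with hA
  set a : ℝ := volume.real A with ha
  have haη : a ≤ unitBallVol N * r ^ N / 2 ^ (N + 1) := (hmono (by linarith)).trans hd
  rcases (show 0 ≤ a from measureReal_nonneg).eq_or_lt with h0 | hapos
  · have h1 : volume.real ({x | t + 2 * s < |f x|} ∩ ball (0 : EN N) r) ≤ a :=
      hmono (by linarith)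
    rw [← h0] at h1 ⊢
    refine h1.trans ?_
    positivity
  set ρ : ℝ := 2 * (2 * a / unitBallVol N) ^ (1 / N : ℝ) with hρ
  have hρ0 : 0 < ρ := by positivity
  have hρN : unitBallVol N * (ρ / 2) ^ N = 2 * a := by
    rw [hρ, mul_div_cancel_left₀ _ two_ne_zero, ← Real.rpow_natCast, ← Real.rpow_mul (by positivity),
      one_div_mul_cancel hNR.ne', Real.rpow_one]
    field_simp
  have hρr : ρ ≤ r := by
    refine le_of_pow_le_pow_left₀ hN.ne' hr.le ?_
    have h1 : unitBallVol N * ρ ^ N = 2 ^ N * (2 * a) := by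
      rw [← hρN, div_pow]; field_simp
    have h2 : 2 ^ N * (2 * a) ≤ unitBallVol N * r ^ N := by
      rw [le_div_iff₀ (by positivity)] at haη
      calc _ = a * 2 ^ (N + 1) := by ring
        _ ≤ _ := haη
    rw [← h1] at h2
    exact le_of_mul_le_mul_left h2 hω
  have key : volume ({x | t + 2 * s < |f x|} ∩ ball (0 : EN N) r) ≤
      ENNReal.ofReal (M / (s ^ 2 / ρ ^ ((N : ℝ) + 2 * α) * a)) := by
    refine volume_le_of_oscillation hα hf hM hs hρ0 hapos fun x ⟨hxf, hxr⟩ => ?_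
    have hxr' : ‖x‖ < r := by simpa using hxr
    set c : EN N := (1 - ρ / (2 * r)) • x with hc
    have hq0 : 0 < ρ / (2 * r) := by positivity
    have hq1 : ρ / (2 * r) ≤ 1 := by rw [div_le_one (by positivity)]; linarith
    have hcn : ‖c‖ ≤ r - ρ / 2 := by
      rw [hc, norm_smul, Real.norm_of_nonneg (by linarith)]
      calc _ ≤ (1 - ρ / (2 * r)) * r := by gcongr
        _ = _ := by field_simp
    have hxc : ‖x - c‖ ≤ ρ / 2 := by
      have : x - c = (ρ / (2 * r)) • x := by rw [hc]; module
      rw [this, norm_smul, Real.norm_of_nonneg hq0.le]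
      calc _ ≤ (ρ / (2 * r)) * r := by gcongr
        _ = _ := by field_simp
    have hmA : MeasurableSet A := (measurableSet_superlevel hf _).inter measurableSet_ball
    refine ⟨ball c (ρ / 2) \ A, measurableSet_ball.diff hmA, ?_, ?_⟩
    · have h1 : volume (ball c (ρ / 2)) - volume A ≤ volume (ball c (ρ / 2) \ A) :=
        le_measure_sdiff
      refine le_trans (le_of_eq ?_) h1
      rw [volume_ball_eq _ (by positivity), hρN, ← ofReal_measureReal (hfin (t + s)), ← hA, ← ha,
        ← ENNReal.ofReal_sub _ hapos.le]
      congr 1; ring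
    · rintro y ⟨hyc, hyA⟩
      rw [mem_ball, dist_eq_norm] at hyc
      have hy0 : ‖y‖ < r := by
        calc ‖y‖ = ‖(y - c) + c‖ := by simp
          _ ≤ ‖y - c‖ + ‖c‖ := norm_add_le _ _
          _ < r := by linarith
      have hyf : |f y| ≤ t + s := by
        by_contra! h
        exact hyA ⟨h, by simpa using hy0⟩
      constructor
      · have := abs_sub_abs_le_abs_sub (f x) (f y)
        have hxf' : t + 2 * s < |f x| := hxf
        linarith
      · calc ‖x - y‖ = ‖(x - c) + (c - y)‖ := by simp
          _ ≤ ‖x - c‖ + ‖c - y‖ := norm_add_le _ _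
          _ ≤ ρ := by rw [norm_sub_rev c y]; linarith
  have key' := ENNReal.toReal_le_of_le_ofReal (by positivity) key
  refine key'.trans (le_of_eq ?_)
  have e1 : ρ ^ ((N : ℝ) + 2 * α) =
      (2 * (2 / unitBallVol N) ^ (1 / N : ℝ)) ^ ((N : ℝ) + 2 * α) * (a * a ^ (2 * α / N)) := by
    have : ρ = (2 * (2 / unitBallVol N) ^ (1 / N : ℝ)) * a ^ (1 / N : ℝ) := by
      rw [hρ, mul_assoc, ← Real.mul_rpow (by positivity) hapos.le]
      congr 2; ring
    rw [this, Real.mul_rpow (by positivity) (by positivity), ← Real.rpow_mul hapos.le]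
    congr 1
    rw [← Real.rpow_one_add' hapos.le (by positivity)]
    congr 1
    field_simp
  rw [e1, Real.rpow_neg hs.le]
  norm_cast
  field_simp

/-- Propagation of the smallness of the relative measure of a superlevel set to a ball of twice
the radius, at the price of slightly raising the level. -/
lemma volumeReal_superlevel_double (hα : 0 < α) {f : EN N → ℝ} (hf : Measurable f)
    {M : ℝ} (hM0 : 0 ≤ M) (hM : gagSq N α f ≤ ENNReal.ofReal M) {r t s : ℝ} (hr : 0 < r)
    (hs : 0 < s)
    (hd : volume.real ({x | t < |f x|} ∩ ball 0 r) ≤ unitBallVol N * r ^ N / 2 ^ (N + 1))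
    (hsr : 2 * M * 3 ^ ((N : ℝ) + 2 * α) * 2 / unitBallVol N ^ 2 * r ^ (2 * α - N) ≤ s ^ 2) :
    volume.real ({x | t + s < |f x|} ∩ ball 0 (2 * r)) ≤
      unitBallVol N * (2 * r) ^ N / 2 ^ (N + 1) := by
  have hω := unitBallVol_pos (N := N)
  have hmA : MeasurableSet {x | t < |f x|} := measurableSet_superlevel hf _
  have hm : 0 < unitBallVol N * r ^ N / 2 := by positivity
  have hF : unitBallVol N * r ^ N / 2 ≤ volume.real (ball (0 : EN N) r \ {x | t < |f x|}) := by
    have h1 := measureReal_sdiff_add_inter (μ := volume) (s := ball (0 : EN N) r) hmA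
      measure_ball_lt_top.ne
    rw [volumeReal_ball_eq _ hr, inter_comm] at h1
    have h2 : unitBallVol N * r ^ N / 2 ^ (N + 1) ≤ unitBallVol N * r ^ N / 2 := by
      gcongr
      calc (2 : ℝ) = 2 ^ 1 := by norm_num
        _ ≤ 2 ^ (N + 1) := by gcongr <;> norm_num
    linarith
  have key : volume ({x | t + s < |f x|} ∩ ball (0 : EN N) (2 * r)) ≤
      ENNReal.ofReal (M / (s ^ 2 / (3 * r) ^ ((N : ℝ) + 2 * α) * (unitBallVol N * r ^ N / 2))) := by
    refine volume_le_of_oscillation hα hf hM hs (by positivity) hm fun x ⟨hxf, hxr⟩ =>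
      ⟨ball (0 : EN N) r \ {x | t < |f x|}, measurableSet_ball.diff hmA, ?_, ?_⟩
    · exact ENNReal.ofReal_le_of_le_toReal hF
    · rintro y ⟨hyr, hyf⟩
      have hxf' : t + s < |f x| := hxf
      have hyf' : |f y| ≤ t := not_lt.1 hyf
      have hxr' : ‖x‖ < 2 * r := by simpa using hxr
      have hyr' : ‖y‖ < r := by simpa using hyr
      exact ⟨by linarith [abs_sub_abs_le_abs_sub (f x) (f y)],
        by linarith [norm_sub_le x y]⟩
  refine (ENNReal.toReal_le_of_le_ofReal (by positivity) key).trans ?_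
  have e2 : r ^ (2 * α - N) = r ^ ((N : ℝ) + 2 * α) / (r ^ N * r ^ N) := by
    rw [← pow_add, ← Real.rpow_natCast r (N + N), ← Real.rpow_sub hr]
    congr 1; push_cast; ring
  have e3 : unitBallVol N * (2 * r) ^ N / 2 ^ (N + 1) = unitBallVol N * r ^ N / 2 := by
    rw [mul_pow, pow_succ]; field_simp
  rw [e3, div_le_iff₀ (by positivity)]
  rw [e2] at hsr
  rw [Real.mul_rpow (by norm_num) hr.le]
  set P := r ^ ((N : ℝ) + 2 * α)
  set Q := (3 : ℝ) ^ ((N : ℝ) + 2 * α)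
  have hP : 0 < P := by positivity
  have hQ : 0 < Q := by positivity
  calc M = (2 * M * Q * 2 / unitBallVol N ^ 2 * (P / (r ^ N * r ^ N))) *
        (unitBallVol N * r ^ N / 2 * (1 / (Q * P) * (unitBallVol N * r ^ N / 2))) := by
        field_simp
    _ ≤ s ^ 2 * (unitBallVol N * r ^ N / 2 * (1 / (Q * P) * (unitBallVol N * r ^ N / 2))) := by
        gcongr
    _ = _ := by ring

/-- If a superlevel set of `f` has small relative measure in a ball of radius `r₀`, then a slightly
higher superlevel set has small relative measure in all the balls of radius `r₀ * 2 ^ j`. -/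
lemma volumeReal_superlevel_dyadic (hα : 0 < α) {f : EN N → ℝ} (hf : Measurable f)
    {M : ℝ} (hM0 : 0 ≤ M) (hM : gagSq N α f ≤ ENNReal.ofReal M) {r₀ δ : ℝ} (hr₀ : 0 < r₀)
    (hδ : 0 < δ) (hN : 2 * α < N)
    (hr : 2 * M * 3 ^ ((N : ℝ) + 2 * α) * 2 / unitBallVol N ^ 2 * r₀ ^ (2 * α - N) ≤
      (δ * (1 - 2 ^ ((2 * α - N) / 2))) ^ 2)
    (hd : volume.real ({x | δ < |f x|} ∩ ball 0 r₀) ≤ unitBallVol N * r₀ ^ N / 2 ^ (N + 1))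
    (j : ℕ) :
    volume.real ({x | 2 * δ < |f x|} ∩ ball 0 (2 ^ j * r₀)) ≤
      unitBallVol N * (2 ^ j * r₀) ^ N / 2 ^ (N + 1) := by
  set ρ : ℝ := 2 ^ ((2 * α - N) / 2) with hρ
  have hρ0 : 0 < ρ := by positivity
  have hρ1 : ρ < 1 := Real.rpow_lt_one_of_one_lt_of_neg (by norm_num) (by linarith)
  have hρ2 : (2 : ℝ) ^ (2 * α - N) = ρ ^ 2 := by
    rw [hρ, ← Real.rpow_mul_natCast (by norm_num)]; congr 1; push_cast; ring
  have main : ∀ j : ℕ, volume.real ({x | 2 * δ - δ * ρ ^ j < |f x|} ∩ ball 0 (2 ^ j * r₀)) ≤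
      unitBallVol N * (2 ^ j * r₀) ^ N / 2 ^ (N + 1) := by
    intro j
    induction j with
    | zero =>
      have : 2 * δ - δ = δ := by ring
      simpa [this] using hd
    | succ j ih =>
      have h := volumeReal_superlevel_double hα hf hM0 hM (by positivity)
        (s := δ * (1 - ρ) * ρ ^ j) (by have := sub_pos.2 hρ1; positivity) ih ?_
      · have e1 : 2 * δ - δ * ρ ^ j + δ * (1 - ρ) * ρ ^ j = 2 * δ - δ * ρ ^ (j + 1) := by ring
        have e2 : 2 * (2 ^ j * r₀) = 2 ^ (j + 1) * r₀ := by ring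
        rwa [e1, e2] at h
      · have e3 : ((2 : ℝ) ^ j) ^ (2 * α - N) = (ρ ^ 2) ^ j := by
          rw [← hρ2, ← Real.rpow_natCast_mul (by norm_num), mul_comm,
            Real.rpow_mul_natCast (by norm_num)]
        rw [Real.mul_rpow (by positivity) hr₀.le, e3]
        calc _ = (2 * M * 3 ^ ((N : ℝ) + 2 * α) * 2 / unitBallVol N ^ 2 * r₀ ^ (2 * α - N)) *
              (ρ ^ 2) ^ j := by ring
          _ ≤ (δ * (1 - ρ)) ^ 2 * (ρ ^ 2) ^ j := by gcongr
          _ = _ := by ring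
  refine le_trans (measureReal_mono (inter_subset_inter_left _ fun x hx => ?_)
    (measure_ne_top_of_subset inter_subset_right measure_ball_lt_top.ne)) (main j)
  have hx' : 2 * δ < |f x| := hx
  have : 0 < δ * ρ ^ j := by positivity
  simp only [mem_ofPred_eq]
  linarith

/-- Weak type Sobolev inequality: if the superlevel set `{|f| > δ}` has small relative measure
in a large enough ball, then the superlevel sets above `2δ` decay with the critical exponent. -/
lemma exists_weak_sobolev (hα : 0 < α) (hN : 2 * α < N) {M : ℝ} (hM0 : 0 ≤ M) :
    ∃ B : ℝ, 0 < B ∧ ∀ δ : ℝ, 0 < δ → ∃ r₀ : ℝ, 0 < r₀ ∧ ∀ f : EN N → ℝ, Measurable f →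
      gagSq N α f ≤ ENNReal.ofReal M →
      volume.real ({x | δ < |f x|} ∩ ball 0 r₀) ≤ unitBallVol N * r₀ ^ N / 2 ^ (N + 1) →
      ∀ s : ℝ, 0 < s →
        volume {x | 2 * δ + s < |f x|} ≤ ENNReal.ofReal (B * s ^ (-critExp N α)) := by
  have hNR : (0 : ℝ) < N := by linarith
  have hN0 : 0 < N := by exact_mod_cast hNR
  have hθ1 : 2 * α / N < 1 := by rwa [div_lt_one hNR]
  set M' : ℝ := M * (2 * (2 / unitBallVol N) ^ (1 / N : ℝ)) ^ ((N : ℝ) + 2 * α)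
  have hp : 2 / (1 - 2 * α / N) = critExp N α := by
    have : (N : ℝ) - 2 * α ≠ 0 := by linarith
    unfold critExp
    field_simp
  refine ⟨(max 1 (2 ^ (2 / (1 - 2 * α / N)) * M')) ^ (1 / (1 - 2 * α / N)), by positivity,
    fun δ hδ => ?_⟩
  have hρ1 : (2 : ℝ) ^ ((2 * α - N) / 2) < 1 :=
    Real.rpow_lt_one_of_one_lt_of_neg (by norm_num) (by linarith)
  have hlim : Tendsto (fun r : ℝ => 2 * M * 3 ^ ((N : ℝ) + 2 * α) * 2 / unitBallVol N ^ 2 *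
      r ^ (2 * α - N)) atTop (nhds 0) := by
    have := (tendsto_rpow_neg_atTop (y := (N : ℝ) - 2 * α) (by linarith)).const_mul
      (2 * M * 3 ^ ((N : ℝ) + 2 * α) * 2 / unitBallVol N ^ 2)
    simpa using this
  obtain ⟨r₀, hr, hr₀⟩ := ((hlim.eventually (ge_mem_nhds (b := 0)
    (a := (δ * (1 - 2 ^ ((2 * α - N) / 2))) ^ 2)
    (by have := sub_pos.2 hρ1; positivity))).and (eventually_gt_atTop 0)).exists
  refine ⟨r₀, hr₀, fun f hf hM hd s hs => ?_⟩
  have hball : ∀ j : ℕ, volume ({x | 2 * δ + s < |f x|} ∩ ball 0 (2 ^ j * r₀)) ≤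
      ENNReal.ofReal ((max 1 (2 ^ (2 / (1 - 2 * α / N)) * M')) ^ (1 / (1 - 2 * α / N)) *
        s ^ (-critExp N α)) := by
    intro j
    have hj := volumeReal_superlevel_dyadic hα hf hM0 hM hr₀ hδ hN hr hd j
    have h := le_mul_rpow_of_dyadic_decay (M := M') (θ := 2 * α / N)
      (a := fun s => volume.real ({x | 2 * δ + s < |f x|} ∩ ball 0 (2 ^ j * r₀)))
      (A := volume.real (ball (0 : EN N) (2 ^ j * r₀))) (fun _ _ => measureReal_nonneg)
      (fun _ _ => measureReal_mono inter_subset_right measure_ball_lt_top.ne) (by positivity) hθ1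
      (fun s hs => volumeReal_superlevel_decay hα hN0 hf hM0 hM (by positivity) hs hj) hs
    rw [hp] at h ⊢
    rw [← ofReal_measureReal
      (measure_ne_top_of_subset inter_subset_right measure_ball_lt_top.ne)]
    exact ENNReal.ofReal_le_ofReal h
  have hunion : {x | 2 * δ + s < |f x|} =
      ⋃ j : ℕ, {x | 2 * δ + s < |f x|} ∩ ball 0 (2 ^ j * r₀) := by
    rw [← inter_iUnion, eq_comm, inter_eq_left]
    intro x _
    obtain ⟨j, hj⟩ := pow_unbounded_of_one_lt (‖x‖ / r₀) (one_lt_two)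
    rw [div_lt_iff₀ hr₀] at hj
    exact mem_iUnion.2 ⟨j, by simpa using hj⟩
  rw [hunion, Monotone.measure_iUnion]
  · exact iSup_le hball
  · intro i j hij
    refine inter_subset_inter_right _ (ball_subset_ball ?_)
    have : (2 : ℝ) ^ i ≤ 2 ^ j := pow_le_pow_right₀ (by norm_num) hij
    gcongr

/-- If `|f x|` is much larger than the average of `f` over a small ball around `x`, then the
Gagliardo density of `f` at `x` is large. -/
lemma le_gagDensity_of_average (hα : 0 < α) {f : EN N → ℝ} {x : EN N} {h δ : ℝ} (hh : 0 < h)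
    (hδ : 0 < δ) (hfi : IntegrableOn f (ball x h))
    (hav : |∫ y in ball x h, f y| ≤ δ / 2 * (unitBallVol N * h ^ N)) (hfx : δ < |f x|) :
    ENNReal.ofReal (δ ^ 2 / 4 * unitBallVol N * h ^ (-(2 * α))) ≤ gagDensity N α f x := by
  have hω := unitBallVol_pos (N := N)
  have hvol : volume.real (ball x h) = unitBallVol N * h ^ N := volumeReal_ball_eq x hh
  have hcint : ∀ c : ℝ, IntegrableOn (fun _ => c) (ball x h) := fun c =>
    integrableOn_const measure_ball_lt_top.ne
  have hint : IntegrableOn (fun y => f x - f y) (ball x h) := (hcint _).sub hfi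
  have h1 : δ / 2 * (unitBallVol N * h ^ N) ≤ ∫ y in ball x h, |f x - f y| := by
    have e : ∫ y in ball x h, (f x - f y) =
        unitBallVol N * h ^ N * f x - ∫ y in ball x h, f y := by
      rw [integral_sub (hcint _) hfi, setIntegral_const, hvol, smul_eq_mul]
    have h2 := abs_integral_le_integral_abs (μ := volume.restrict (ball x h))
      (f := fun y => f x - f y)
    rw [e] at h2
    have h3 := abs_sub_abs_le_abs_sub (unitBallVol N * h ^ N * f x) (∫ y in ball x h, f y)
    rw [abs_mul, abs_of_pos (by positivity : 0 < unitBallVol N * h ^ N)] at h3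
    have h4 : unitBallVol N * h ^ N * δ ≤ unitBallVol N * h ^ N * |f x| := by gcongr
    linarith
  have h2 : ENNReal.ofReal (δ / 4 * (unitBallVol N * h ^ N)) ≤
      ∫⁻ y in ball x h, ENNReal.ofReal (|f x - f y| - δ / 4) := by
    have h3 : δ / 4 * (unitBallVol N * h ^ N) ≤ ∫ y in ball x h, (|f x - f y| - δ / 4) := by
      rw [integral_sub hint.abs (hcint _), setIntegral_const, hvol, smul_eq_mul]
      linarith
    refine (ENNReal.ofReal_le_ofReal h3).trans ?_
    rw [integral_eq_lintegral_pos_part_sub_lintegral_neg_part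
      (f := fun y => |f x - f y| - δ / 4) (hint.abs.sub (hcint _))]
    refine (ENNReal.ofReal_le_ofReal (sub_le_self _ ENNReal.toReal_nonneg)).trans ?_
    exact ENNReal.ofReal_toReal_le
  have h3 : ∫⁻ y in ball x h, ENNReal.ofReal (|f x - f y| - δ / 4) ≤
      ENNReal.ofReal (h ^ ((N : ℝ) + 2 * α) / δ) * gagDensity N α f x := by
    calc _ ≤ ∫⁻ y in ball x h, ENNReal.ofReal (h ^ ((N : ℝ) + 2 * α) / δ) *
          ENNReal.ofReal ((f x - f y) ^ 2 / h ^ ((N : ℝ) + 2 * α)) := by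
          refine lintegral_mono fun y => ?_
          rw [← ENNReal.ofReal_mul (by positivity)]
          refine ENNReal.ofReal_le_ofReal ?_
          rw [← sq_abs (f x - f y)]
          have : h ^ ((N : ℝ) + 2 * α) / δ * (|f x - f y| ^ 2 / h ^ ((N : ℝ) + 2 * α)) =
              |f x - f y| ^ 2 / δ := by field_simp
          rw [this, le_div_iff₀ hδ]
          nlinarith [sq_nonneg (|f x - f y| - δ / 2)]
      _ = ENNReal.ofReal (h ^ ((N : ℝ) + 2 * α) / δ) * ∫⁻ y in ball x h,
          ENNReal.ofReal ((f x - f y) ^ 2 / h ^ ((N : ℝ) + 2 * α)) :=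
          lintegral_const_mul' _ _ ENNReal.ofReal_ne_top
      _ ≤ _ := by
          gcongr
          refine setLIntegral_sq_le_gagDensity hα measurableSet_ball fun y hy => ?_
          rw [← dist_eq_norm, dist_comm]
          exact (mem_ball.1 hy).le
  have h4 := h2.trans h3
  have e : δ / 4 * (unitBallVol N * h ^ N) = h ^ ((N : ℝ) + 2 * α) / δ *
      (δ ^ 2 / 4 * unitBallVol N * h ^ (-(2 * α))) := by
    rw [Real.rpow_neg hh.le, Real.rpow_add hh, Real.rpow_natCast]
    field_simp
  rw [e, ENNReal.ofReal_mul (by positivity)] at h4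
  exact (ENNReal.mul_le_mul_iff_right (by simp; positivity) ENNReal.ofReal_ne_top).1 h4

lemma measurable_integral_ball {f : EN N → ℝ} (hf : Measurable f) (h : ℝ) :
    StronglyMeasurable fun x => ∫ y in ball x h, f y := by
  have h1 : (fun x => ∫ y in ball x h, f y) =
      fun x => ∫ y, {p : EN N × EN N | dist p.2 p.1 < h}.indicator (fun p => f p.2) (x, y) := by
    ext x
    rw [← integral_indicator measurableSet_ball]
    rfl
  rw [h1]
  refine StronglyMeasurable.integral_prod_right' (Measurable.stronglyMeasurable ?_)
  exact (hf.comp measurable_snd).indicator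
    (measurableSet_lt (measurable_snd.dist measurable_fst) measurable_const)

/-- Local compactness: a sequence with bounded Gagliardo seminorms whose averages over balls tend
to zero tends to zero locally in measure. -/
lemma tendsto_volume_superlevel_inter_ball (hα : 0 < α) {z : ℕ → EN N → ℝ}
    (hz : ∀ n, Measurable (z n)) {M : ℝ}
    (hM : ∀ n, gagSq N α (z n) ≤ ENNReal.ofReal M)
    (hzi : ∀ n x h, IntegrableOn (z n) (ball x h))
    (hav : ∀ x h, Tendsto (fun n => ∫ y in ball x h, z n y) atTop (nhds 0))
    {δ : ℝ} (hδ : 0 < δ) (r : ℝ) :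
    Tendsto (fun n => volume ({x | δ < |z n x|} ∩ ball 0 r)) atTop (nhds 0) := by
  have hω := unitBallVol_pos (N := N)
  rw [ENNReal.tendsto_nhds_zero]
  intro ε hε
  have hlim : Tendsto (fun h : ℝ => ENNReal.ofReal
      (M / (δ ^ 2 / 4 * unitBallVol N * h ^ (2 * α)))) atTop (nhds 0) := by
    rw [← ENNReal.ofReal_zero]
    refine ENNReal.tendsto_ofReal (Tendsto.const_div_atTop ?_ _)
    exact (tendsto_rpow_atTop (by positivity)).const_mul_atTop (by positivity)
  obtain ⟨k, hk, hk0⟩ := ((hlim.eventually (ge_mem_nhds (ENNReal.half_pos hε.ne'))).and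
    (eventually_gt_atTop 0)).exists
  set h : ℝ := k⁻¹ with hh
  have hh0 : 0 < h := by positivity
  have hkh : k ^ (2 * α) = h ^ (-(2 * α)) := by
    rw [hh, Real.rpow_neg (by positivity), Real.inv_rpow hk0.le, inv_inv]
  rw [hkh] at hk
  have hmeas : TendstoInMeasure (volume.restrict (ball (0 : EN N) r))
      (fun n x => ∫ y in ball x h, z n y) atTop (fun _ => (0 : ℝ)) := by
    have : IsFiniteMeasure (volume.restrict (ball (0 : EN N) r)) :=
      ⟨by simpa using measure_ball_lt_top⟩
    exact tendstoInMeasure_of_tendsto_ae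
      (fun n => (measurable_integral_ball (hz n) h).aestronglyMeasurable)
      (Eventually.of_forall fun x => hav x h)
  rw [tendstoInMeasure_iff_norm] at hmeas
  have h2 := hmeas (δ / 2 * (unitBallVol N * h ^ N)) (by positivity)
  filter_upwards [h2.eventually (ge_mem_nhds (ENNReal.half_pos hε.ne'))] with n hn
  set S₁ : Set (EN N) := {x | ENNReal.ofReal (δ ^ 2 / 4 * unitBallVol N * h ^ (-(2 * α))) ≤
    gagDensity N α (z n) x}
  set S₂ : Set (EN N) := {x | δ / 2 * (unitBallVol N * h ^ N) ≤ ‖(∫ y in ball x h, z n y) - 0‖}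
  have hsub : {x | δ < |z n x|} ∩ ball 0 r ⊆ S₁ ∪ (S₂ ∩ ball 0 r) := by
    rintro x ⟨hx, hxr⟩
    by_cases hx2 : x ∈ S₂
    · exact Or.inr ⟨hx2, hxr⟩
    · refine Or.inl (le_gagDensity_of_average hα hh0 hδ (hzi n x h) ?_ hx)
      have hx2' : ¬ δ / 2 * (unitBallVol N * h ^ N) ≤ ‖(∫ y in ball x h, z n y) - 0‖ := hx2
      rw [sub_zero, Real.norm_eq_abs] at hx2'
      exact (not_le.1 hx2').le
  rw [Measure.restrict_apply' measurableSet_ball] at hn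
  have hS1 : volume S₁ ≤ ε / 2 :=
    (volume_le_of_le_gagDensity (hz n) (by positivity) (hM n) fun x hx => hx).trans hk
  calc _ ≤ volume S₁ + volume (S₂ ∩ ball 0 r) := (measure_mono hsub).trans (measure_union_le _ _)
    _ ≤ ε / 2 + ε / 2 := add_le_add hS1 hn
    _ = ε := ENNReal.add_halves ε

/-- In a Hilbert space, a bounded sequence in a subspace `S` which tends weakly to zero against the
elements of `S` tends weakly to zero. -/
lemma tendsto_inner_zero_of_submodule {H : Type*} [NormedAddCommGroup H] [InnerProductSpace ℝ H]
    [CompleteSpace H] (S : Submodule ℝ H) {x : ℕ → H} {C : ℝ} (hx : ∀ n, x n ∈ S)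
    (hC : ∀ n, ‖x n‖ ≤ C) (h : ∀ s ∈ S, Tendsto (fun n => inner ℝ (x n) s) atTop (nhds 0))
    (v : H) : Tendsto (fun n => inner ℝ (x n) v) atTop (nhds 0) := by
  set K := S.topologicalClosure
  have : CompleteSpace K := S.isClosed_topologicalClosure.completeSpace_coe
  set p := K.starProjection v with hp
  have hpK : p ∈ closure (S : Set H) := Submodule.starProjection_apply_mem K v
  have hvp : ∀ n, inner ℝ (x n) v = inner ℝ (x n) p := by
    intro n
    have := Submodule.starProjection_inner_eq_zero (K := K) v (x n)
      (S.le_topologicalClosure (hx n))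
    rw [real_inner_comm, inner_sub_right, sub_eq_zero] at this
    exact this
  have hC0 : 0 ≤ C := (norm_nonneg _).trans (hC 0)
  rw [Metric.tendsto_atTop]
  intro ε hε
  obtain ⟨s, hs, hps⟩ := Metric.mem_closure_iff.1 hpK (ε / (2 * (C + 1))) (by positivity)
  obtain ⟨n₀, hn₀⟩ := Metric.tendsto_atTop.1 (h s hs) (ε / 2) (by positivity)
  refine ⟨n₀, fun n hn => ?_⟩
  have h1 := hn₀ n hn
  rw [dist_zero_right, Real.norm_eq_abs] at h1 ⊢
  rw [dist_eq_norm] at hps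
  have h2 : |inner ℝ (x n) (p - s)| ≤ C * (ε / (2 * (C + 1))) := by
    refine (abs_real_inner_le_norm _ _).trans ?_
    gcongr
    exact hC n
  have h3 : C * (ε / (2 * (C + 1))) ≤ ε / 2 := by
    rw [← mul_div_assoc, div_le_div_iff₀ (by positivity) (by positivity)]
    nlinarith
  have e : inner ℝ (x n) v = inner ℝ (x n) (p - s) + inner ℝ (x n) s := by
    rw [hvp, inner_sub_right]; ring
  rw [e]
  exact (abs_add_le _ _).trans_lt (by linarith)

lemma gagSq_lt_top {f : EN N → ℝ} (hf : memX α V f) : gagSq N α f < ⊤ :=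
  lt_of_le_of_lt le_self_add hf.2

lemma lintegral_potential_lt_top {f : EN N → ℝ} (hf : memX α V f) :
    ∫⁻ x, ENNReal.ofReal (V x * f x ^ 2) < ⊤ :=
  lt_of_le_of_lt le_add_self hf.2

lemma ofReal_mul_add_sq_le {a b c : ℝ} (hc : 0 ≤ c) :
    ENNReal.ofReal (c * (a + b) ^ 2) ≤
      2 * ENNReal.ofReal (c * a ^ 2) + 2 * ENNReal.ofReal (c * b ^ 2) := by
  rw [← mul_add, ← ENNReal.ofReal_add (by positivity) (by positivity),
    show (2 : ENNReal) = ENNReal.ofReal 2 by simp, ← ENNReal.ofReal_mul (by norm_num)]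
  refine ENNReal.ofReal_le_ofReal ?_
  nlinarith [mul_nonneg hc (sq_nonneg (a - b))]

lemma normSq_add_le (hV : Continuous V) (hV0 : ∀ x, 0 < V x) {f g : EN N → ℝ}
    (hf : Measurable f) (hg : Measurable g) :
    normSq α V (f + g) ≤ 2 * normSq α V f + 2 * normSq α V g := by
  have hVm := hV.measurable
  have h1 : gagSq N α (f + g) ≤ 2 * gagSq N α f + 2 * gagSq N α g := by
    unfold gagSq
    rw [← lintegral_const_mul _ (measurable_gag_integrand hf),
      ← lintegral_const_mul _ (measurable_gag_integrand hg),
      ← lintegral_add_left ((measurable_gag_integrand hf).const_mul _)]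
    refine lintegral_mono fun p => ?_
    have := ofReal_mul_add_sq_le (a := f p.1 - f p.2) (b := g p.1 - g p.2)
      (c := (‖p.1 - p.2‖ ^ ((N : ℝ) + 2 * α))⁻¹) (by positivity)
    simp only [Pi.add_apply, div_eq_inv_mul]
    convert this using 4
    ring
  have h2 : ∫⁻ x, ENNReal.ofReal (V x * (f + g) x ^ 2) ≤
      2 * (∫⁻ x, ENNReal.ofReal (V x * f x ^ 2)) + 2 * ∫⁻ x, ENNReal.ofReal (V x * g x ^ 2) := by
    rw [← lintegral_const_mul _ (by fun_prop), ← lintegral_const_mul _ (by fun_prop),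
      ← lintegral_add_left (by fun_prop)]
    exact lintegral_mono fun x => ofReal_mul_add_sq_le (hV0 x).le
  calc _ ≤ _ := add_le_add h1 h2
    _ = _ := by unfold normSq; ring

lemma normSq_smul (c : ℝ) (f : EN N → ℝ) :
    normSq α V (c • f) = ENNReal.ofReal (c ^ 2) * normSq α V f := by
  unfold normSq gagSq
  rw [mul_add, ← lintegral_const_mul' _ _ ENNReal.ofReal_ne_top,
    ← lintegral_const_mul' _ _ ENNReal.ofReal_ne_top]
  congr 1 <;>
  · refine lintegral_congr fun p => ?_
    rw [← ENNReal.ofReal_mul (by positivity)]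
    congr 1
    simp only [Pi.smul_apply, smul_eq_mul]
    ring

lemma memX_add (hV : Continuous V) (hV0 : ∀ x, 0 < V x) {f g : EN N → ℝ}
    (hf : memX α V f) (hg : memX α V g) : memX α V (f + g) :=
  ⟨hf.1.add hg.1, (normSq_add_le hV hV0 hf.1 hg.1).trans_lt
    (ENNReal.add_lt_top.2 ⟨ENNReal.mul_lt_top (by simp) hf.2, ENNReal.mul_lt_top (by simp) hg.2⟩)⟩

lemma memX_smul (c : ℝ) {f : EN N → ℝ} (hf : memX α V f) : memX α V (c • f) :=
  ⟨hf.1.const_smul c, by rw [normSq_smul]; exact ENNReal.mul_lt_top (by simp) hf.2⟩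

lemma memX_zero : memX α V (0 : EN N → ℝ) := by
  refine ⟨measurable_const, ?_⟩
  simp [normSq, gagSq]

/-- The square integrable representative `(f(x) - f(y)) / |x - y|^{(N+2α)/2}` of the Gagliardo
seminorm. -/
def gagQuot (N : ℕ) (α : ℝ) (f : EN N → ℝ) (p : EN N × EN N) : ℝ :=
  (f p.1 - f p.2) / ‖p.1 - p.2‖ ^ (((N : ℝ) + 2 * α) / 2)

lemma gagQuot_mul (f g : EN N → ℝ) (p : EN N × EN N) :
    gagQuot N α f p * gagQuot N α g p =
      (f p.1 - f p.2) * (g p.1 - g p.2) / ‖p.1 - p.2‖ ^ ((N : ℝ) + 2 * α) := by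
  unfold gagQuot
  rw [div_mul_div_comm, ← sq, ← Real.rpow_mul_natCast (norm_nonneg _)]
  congr 2
  push_cast
  ring

lemma measurable_gagQuot {f : EN N → ℝ} (hf : Measurable f) : Measurable (gagQuot N α f) := by
  unfold gagQuot
  fun_prop

lemma memLp_two_of_lintegral_sq {Ω : Type*} [MeasurableSpace Ω] {μ : Measure Ω} {F : Ω → ℝ}
    (hF : Measurable F) (h : ∫⁻ x, ENNReal.ofReal (F x ^ 2) ∂μ < ⊤) : MemLp F 2 μ := by
  rw [memLp_two_iff_integrable_sq hF.aestronglyMeasurable]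
  refine ⟨(hF.pow_const 2).aestronglyMeasurable, ?_⟩
  rw [hasFiniteIntegral_iff_ofReal (Eventually.of_forall fun x => sq_nonneg _)]
  exact h

lemma memLp_gagQuot {f : EN N → ℝ} (hf : memX α V f) : MemLp (gagQuot N α f) 2 volume := by
  refine memLp_two_of_lintegral_sq (measurable_gagQuot hf.1) ?_
  simp_rw [sq, gagQuot_mul, ← sq]
  exact gagSq_lt_top hf

lemma sqrt_mul_mul_sqrt_mul {v : ℝ} (hv : 0 < v) (a b : ℝ) :
    (√v * a) * (√v * b) = v * a * b := by
  calc _ = (√v * √v) * a * b := by ring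
    _ = _ := by rw [Real.mul_self_sqrt hv.le]

lemma memLp_sqrt_mul (hV : Continuous V) (hV0 : ∀ x, 0 < V x) {f : EN N → ℝ} (hf : memX α V f) :
    MemLp (fun x => √(V x) * f x) 2 volume := by
  have hVm := hV.measurable
  have hfm := hf.1
  refine memLp_two_of_lintegral_sq (by fun_prop) ?_
  simp_rw [sq, sqrt_mul_mul_sqrt_mul (hV0 _), mul_assoc, ← sq]
  exact lintegral_potential_lt_top hf

/-- The Hilbert space into which `X` embeds isometrically. -/
abbrev ambientL2 (N : ℕ) :=
  WithLp 2 (Lp ℝ 2 (volume : Measure (EN N × EN N)) × Lp ℝ 2 (volume : Measure (EN N)))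

/-- The isometric embedding of `X` into a product of `L²` spaces. -/
def toAmbientL2 (hV : Continuous V) (hV0 : ∀ x, 0 < V x) (f : EN N → ℝ) (hf : memX α V f) :
    ambientL2 N :=
  WithLp.toLp 2 ((memLp_gagQuot hf).toLp _, (memLp_sqrt_mul hV hV0 hf).toLp _)

lemma inner_toLp_toLp {Ω : Type*} [MeasurableSpace Ω] {μ : Measure Ω} {F G : Ω → ℝ}
    (hF : MemLp F 2 μ) (hG : MemLp G 2 μ) :
    inner ℝ (hF.toLp F) (hG.toLp G) = ∫ x, F x * G x ∂μ := by
  rw [L2.inner_def]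
  refine integral_congr_ae ?_
  filter_upwards [hF.coeFn_toLp, hG.coeFn_toLp] with x h1 h2
  rw [h1, h2]
  simp [mul_comm]

lemma inner_toAmbientL2 (hV : Continuous V) (hV0 : ∀ x, 0 < V x) {f g : EN N → ℝ}
    (hf : memX α V f) (hg : memX α V g) :
    inner ℝ (toAmbientL2 hV hV0 f hf) (toAmbientL2 hV hV0 g hg) =
      (∫ p : EN N × EN N,
        (f p.1 - f p.2) * (g p.1 - g p.2) / ‖p.1 - p.2‖ ^ ((N : ℝ) + 2 * α)) +
        ∫ x, V x * f x * g x := by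
  rw [WithLp.prod_inner_apply]
  simp only [toAmbientL2]
  rw [inner_toLp_toLp, inner_toLp_toLp]
  simp_rw [gagQuot_mul, sqrt_mul_mul_sqrt_mul (hV0 _)]

lemma norm_toAmbientL2_sq (hV : Continuous V) (hV0 : ∀ x, 0 < V x) {f : EN N → ℝ}
    (hf : memX α V f) : ‖toAmbientL2 hV hV0 f hf‖ ^ 2 = (normSq α V f).toReal := by
  have hVm := hV.measurable
  have hfm := hf.1
  rw [← real_inner_self_eq_norm_sq, inner_toAmbientL2, normSq,
    ENNReal.toReal_add (gagSq_lt_top hf).ne (lintegral_potential_lt_top hf).ne]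
  simp_rw [mul_assoc, ← sq]
  congr 1
  · refine integral_eq_lintegral_of_nonneg_ae (Eventually.of_forall fun p => by positivity) ?_
    exact Measurable.aestronglyMeasurable (by fun_prop)
  · refine integral_eq_lintegral_of_nonneg_ae
      (Eventually.of_forall fun x => mul_nonneg (hV0 x).le (sq_nonneg _)) ?_
    exact Measurable.aestronglyMeasurable (by fun_prop)

/-- The image of `X` in the ambient Hilbert space. -/
def imageX (α : ℝ) (hV : Continuous V) (hV0 : ∀ x, 0 < V x) : Submodule ℝ (ambientL2 N) where
  carrier := {h | ∃ f, ∃ hf : memX α V f, h = toAmbientL2 hV hV0 f hf}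
  add_mem' := by
    rintro _ _ ⟨f, hf, rfl⟩ ⟨g, hg, rfl⟩
    refine ⟨f + g, memX_add hV hV0 hf hg, ?_⟩
    unfold toAmbientL2
    rw [← WithLp.toLp_add, Prod.mk_add_mk, ← MemLp.toLp_add, ← MemLp.toLp_add]
    congr 2
    · refine MemLp.toLp_congr _ _ (Eventually.of_forall fun p => ?_)
      simp only [gagQuot, Pi.add_apply]
      ring
    · refine MemLp.toLp_congr _ _ (Eventually.of_forall fun p => ?_)
      simp only [Pi.add_apply]
      ring
  zero_mem' := by
    refine ⟨0, memX_zero, ?_⟩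
    have h := norm_toAmbientL2_sq hV hV0 (memX_zero (α := α) (V := V))
    have h0 : normSq α V (0 : EN N → ℝ) = 0 := by simp [normSq, gagSq]
    rw [h0, ENNReal.toReal_zero, sq_eq_zero_iff, norm_eq_zero] at h
    exact h.symm
  smul_mem' := by
    rintro c _ ⟨f, hf, rfl⟩
    refine ⟨c • f, memX_smul c hf, ?_⟩
    unfold toAmbientL2
    rw [← WithLp.toLp_smul, Prod.smul_mk, ← MemLp.toLp_const_smul, ← MemLp.toLp_const_smul]
    congr 2
    · refine MemLp.toLp_congr _ _ (Eventually.of_forall fun p => ?_)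
      simp only [gagQuot, Pi.smul_apply, smul_eq_mul]
      ring
    · refine MemLp.toLp_congr _ _ (Eventually.of_forall fun p => ?_)
      simp only [Pi.smul_apply, smul_eq_mul]
      ring

lemma memLp_indicator_inv_sqrt (hV : Continuous V) (hV0 : ∀ x, 0 < V x) (x : EN N) (h : ℝ) :
    MemLp ((ball x h).indicator fun y => (√(V y))⁻¹) 2 volume := by
  rw [memLp_indicator_iff_restrict measurableSet_ball]
  have hc : Continuous fun y => (√(V y))⁻¹ :=
    hV.sqrt.inv₀ fun y => (Real.sqrt_pos.2 (hV0 y)).ne'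
  rw [memLp_two_iff_integrable_sq hc.aestronglyMeasurable]
  exact ((hc.pow 2).continuousOn.integrableOn_compact (isCompact_closedBall x h)).mono_set
    ball_subset_closedBall

lemma sqrt_mul_mul_indicator (hV0 : ∀ x, 0 < V x) (f : EN N → ℝ) (x : EN N) (h : ℝ) (y : EN N) :
    √(V y) * f y * (ball x h).indicator (fun y => (√(V y))⁻¹) y = (ball x h).indicator f y := by
  by_cases hy : y ∈ ball x h
  · have := Real.sqrt_pos.2 (hV0 y)
    rw [indicator_of_mem hy, indicator_of_mem hy]
    field_simp
  · simp [indicator_of_notMem hy]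

lemma integrableOn_ball_of_memX (hV : Continuous V) (hV0 : ∀ x, 0 < V x) {f : EN N → ℝ}
    (hf : memX α V f) (x : EN N) (h : ℝ) : IntegrableOn f (ball x h) := by
  rw [← integrable_indicator_iff measurableSet_ball]
  have := (memLp_sqrt_mul hV hV0 hf).integrable_mul (memLp_indicator_inv_sqrt hV hV0 x h)
  refine this.congr (Eventually.of_forall fun y => ?_)
  exact sqrt_mul_mul_indicator hV0 f x h y

/-- Averages over balls are continuous for the weak convergence of bounded sequences of `X`. -/
lemma tendsto_integral_ball (hV : Continuous V) (hV0 : ∀ x, 0 < V x) {z : ℕ → EN N → ℝ}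
    (hz : ∀ n, memX α V (z n)) {M : ℝ} (hM0 : 0 ≤ M)
    (hM : ∀ n, normSq α V (z n) ≤ ENNReal.ofReal M) (hconv : weakConv α V z 0) (x : EN N) (h : ℝ) :
    Tendsto (fun n => ∫ y in ball x h, z n y) atTop (nhds 0) := by
  have key := tendsto_inner_zero_of_submodule (imageX α hV hV0)
    (x := fun n => toAmbientL2 hV hV0 (z n) (hz n)) (C := √M) (fun n => ⟨z n, hz n, rfl⟩)
    (fun n => Real.le_sqrt_of_sq_le (by
      rw [norm_toAmbientL2_sq]; exact ENNReal.toReal_le_of_le_ofReal hM0 (hM n))) ?_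
    (WithLp.toLp 2 (0, (memLp_indicator_inv_sqrt hV hV0 x h).toLp _))
  · refine key.congr fun n => ?_
    rw [WithLp.prod_inner_apply]
    simp only [toAmbientL2]
    rw [inner_toLp_toLp, inner_zero_right, zero_add, ← integral_indicator measurableSet_ball]
    exact integral_congr_ae (Eventually.of_forall (sqrt_mul_mul_indicator hV0 (z n) x h))
  · rintro _ ⟨v, hv, rfl⟩
    simp_rw [inner_toAmbientL2]
    simpa using hconv v hv

/-- Tail estimate for the `q`-th power of a function with superlevel sets decaying with an exponent
`p > q`. -/
lemma setLIntegral_rpow_tail_le {z : EN N → ℝ} (hz : Measurable z) {B p q : ℝ} (hB : 0 < B)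
    (hq : 0 < q) (hqp : q < p)
    (hdec : ∀ t, 1 ≤ t → volume {x | t ≤ |z x|} ≤ ENNReal.ofReal (B * t ^ (-p))) {L : ℝ}
    (hL : 1 ≤ L) :
    ∫⁻ x in {x | L ≤ |z x|}, ENNReal.ofReal (|z x| ^ q) ≤
      ENNReal.ofReal (2 ^ q * B * (1 - 2 ^ (q - p))⁻¹ * L ^ (q - p)) := by
  have hL0 : 0 < L := by linarith
  have hρ1 : (2 : ℝ) ^ (q - p) < 1 :=
    Real.rpow_lt_one_of_one_lt_of_neg (by norm_num) (by linarith)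
  set S : ℕ → Set (EN N) := fun k => {x | 2 ^ k * L ≤ |z x| ∧ |z x| < 2 ^ (k + 1) * L} with hS
  have hSm : ∀ k, MeasurableSet (S k) := fun k =>
    (measurableSet_le measurable_const hz.abs).inter (measurableSet_lt hz.abs measurable_const)
  have hcover : {x | L ≤ |z x|} ⊆ ⋃ k, S k := by
    intro x hx
    have hx' : L ≤ |z x| := hx
    obtain ⟨k, hk1, hk2⟩ := exists_nat_pow_near ((one_le_div hL0).2 hx') one_lt_two
    rw [le_div_iff₀ hL0] at hk1
    rw [div_lt_iff₀ hL0] at hk2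
    exact mem_iUnion.2 ⟨k, hk1, hk2⟩
  have hk : ∀ k, ∫⁻ x in S k, ENNReal.ofReal (|z x| ^ q) ≤
      ENNReal.ofReal (2 ^ q * B * L ^ (q - p) * (2 ^ (q - p)) ^ k) := by
    intro k
    have hpow : (1 : ℝ) ≤ 2 ^ k := one_le_pow₀ (by norm_num)
    calc _ ≤ ∫⁻ x in S k, ENNReal.ofReal ((2 ^ (k + 1) * L) ^ q) := by
          refine setLIntegral_mono' (hSm k) fun x hx => ENNReal.ofReal_le_ofReal ?_
          exact Real.rpow_le_rpow (abs_nonneg _) hx.2.le hq.le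
      _ = ENNReal.ofReal ((2 ^ (k + 1) * L) ^ q) * volume (S k) := setLIntegral_const _ _
      _ ≤ ENNReal.ofReal ((2 ^ (k + 1) * L) ^ q) *
          ENNReal.ofReal (B * (2 ^ k * L) ^ (-p)) := by
          gcongr
          exact (measure_mono fun x hx => hx.1).trans (hdec _ (by nlinarith))
      _ = _ := by
          rw [← ENNReal.ofReal_mul (by positivity)]
          congr 1
          have e1 : (2 ^ (k + 1) * L) ^ q = 2 ^ q * (2 ^ k * L) ^ q := by
            rw [← Real.mul_rpow (by norm_num) (by positivity)]; congr 1; ring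
          have e2 : (2 ^ k * L) ^ q * (2 ^ k * L) ^ (-p) = (2 ^ k * L) ^ (q - p) := by
            rw [← Real.rpow_add (by positivity), sub_eq_add_neg]
          have e3 : (2 ^ k * L) ^ (q - p) = (2 ^ (q - p)) ^ k * L ^ (q - p) := by
            rw [Real.mul_rpow (by positivity) hL0.le, ← Real.rpow_natCast_mul (by norm_num),
              mul_comm (k : ℝ), Real.rpow_mul_natCast (by norm_num)]
          calc _ = 2 ^ q * B * ((2 ^ k * L) ^ q * (2 ^ k * L) ^ (-p)) := by rw [e1]; ring
            _ = _ := by rw [e2, e3]; ring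
  calc _ ≤ ∫⁻ x in ⋃ k, S k, ENNReal.ofReal (|z x| ^ q) := lintegral_mono_set hcover
    _ ≤ ∑' k, ∫⁻ x in S k, ENNReal.ofReal (|z x| ^ q) := lintegral_iUnion_le _ _
    _ ≤ ∑' k : ℕ, ENNReal.ofReal (2 ^ q * B * L ^ (q - p) * (2 ^ (q - p)) ^ k) :=
        ENNReal.tsum_le_tsum hk
    _ = _ := by
        rw [← ENNReal.ofReal_tsum_of_nonneg (fun k => by positivity)
          ((summable_geometric_of_lt_one (by positivity) hρ1).mul_left _), tsum_mul_left,
          tsum_geometric_of_lt_one (by positivity) hρ1]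
        congr 1; ring

/-- The weighted `L^q` integral over the region where `|z|` is small. -/
lemma setLIntegral_small_le (hV0 : ∀ x, 0 < V x) (hK0 : ∀ x, 0 < K x) {C : ℝ} (hC : 0 < C)
    (hKV : ∀ x, K x ≤ C * V x) {z : EN N → ℝ} (hz : Measurable z) {M q δ : ℝ} (hq : 2 < q)
    (hM : ∫⁻ x, ENNReal.ofReal (V x * z x ^ 2) ≤ ENNReal.ofReal M) (hδ : 0 < δ) :
    ∫⁻ x in {x | |z x| ≤ δ}, ENNReal.ofReal (K x * |z x| ^ q) ≤
      ENNReal.ofReal (C * δ ^ (q - 2) * M) := by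
  calc _ ≤ ∫⁻ x in {x | |z x| ≤ δ}, ENNReal.ofReal (C * δ ^ (q - 2)) *
        ENNReal.ofReal (V x * z x ^ 2) := by
        refine setLIntegral_mono' (measurableSet_le hz.abs measurable_const) fun x hx => ?_
        have hx' : |z x| ≤ δ := hx
        have hV := hV0 x
        have hK := hK0 x
        rw [← ENNReal.ofReal_mul (by positivity)]
        refine ENNReal.ofReal_le_ofReal ?_
        have e : |z x| ^ q = |z x| ^ (q - 2) * z x ^ 2 := by
          rw [← sq_abs (z x), ← Real.rpow_natCast, ← Real.rpow_add' (abs_nonneg _)]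
          · congr 1; push_cast; ring
          · push_cast; linarith
        calc K x * |z x| ^ q = K x * (|z x| ^ (q - 2) * z x ^ 2) := by rw [e]
          _ ≤ (C * V x) * (δ ^ (q - 2) * z x ^ 2) := by
            have := Real.rpow_le_rpow (abs_nonneg _) hx' (by linarith : 0 ≤ q - 2)
            gcongr
            exact hKV x
          _ = _ := by ring
    _ ≤ ∫⁻ x, ENNReal.ofReal (C * δ ^ (q - 2)) * ENNReal.ofReal (V x * z x ^ 2) :=
        setLIntegral_le_lintegral _ _
    _ = ENNReal.ofReal (C * δ ^ (q - 2)) * ∫⁻ x, ENNReal.ofReal (V x * z x ^ 2) :=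
        lintegral_const_mul' _ _ ENNReal.ofReal_ne_top
    _ ≤ _ := (mul_le_mul' le_rfl hM).trans_eq (ENNReal.ofReal_mul (by positivity)).symm

/-- The weighted `L^q` integral over a region where `|z|` is bounded. -/
lemma setLIntegral_bounded_le {z : EN N → ℝ} {S : Set (EN N)} (hS : MeasurableSet S)
    (hK0 : ∀ x, 0 < K x) {L q : ℝ} (hq : 0 < q) (hL : 0 < L) (hSL : ∀ x ∈ S, |z x| ≤ L) :
    ∫⁻ x in S, ENNReal.ofReal (K x * |z x| ^ q) ≤
      ENNReal.ofReal (L ^ q) * ∫⁻ x in S, ENNReal.ofReal (K x) := by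
  rw [← lintegral_const_mul' _ _ ENNReal.ofReal_ne_top]
  refine setLIntegral_mono' hS fun x hx => ?_
  rw [← ENNReal.ofReal_mul (by positivity), mul_comm (L ^ q)]
  refine ENNReal.ofReal_le_ofReal (mul_le_mul_of_nonneg_left ?_ (hK0 x).le)
  exact Real.rpow_le_rpow (abs_nonneg _) (hSL x hx) hq.le

lemma lintegral_le_of_levels (z : EN N → ℝ) (g : EN N → ENNReal) (δ L r : ℝ) :
    ∫⁻ x, g x ≤ (∫⁻ x in {x | |z x| ≤ δ}, g x) +
      (∫⁻ x in ({x | δ < |z x|} ∩ {x | |z x| ≤ L}) ∩ {x | r ≤ ‖x‖}, g x) +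
      (∫⁻ x in ({x | δ < |z x|} ∩ {x | |z x| ≤ L}) ∩ ball 0 r, g x) +
      ∫⁻ x in {x | L ≤ |z x|}, g x := by
  set S₁ : Set (EN N) := {x | |z x| ≤ δ}
  set S₂ : Set (EN N) := ({x | δ < |z x|} ∩ {x | |z x| ≤ L}) ∩ {x | r ≤ ‖x‖}
  set S₃ : Set (EN N) := ({x | δ < |z x|} ∩ {x | |z x| ≤ L}) ∩ ball 0 r
  set S₄ : Set (EN N) := {x | L ≤ |z x|}
  have hcover : (univ : Set (EN N)) ⊆ ((S₁ ∪ S₂) ∪ S₃) ∪ S₄ := by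
    intro x _
    rcases le_or_gt (|z x|) δ with h1 | h1
    · exact Or.inl (Or.inl (Or.inl h1))
    rcases le_or_gt (|z x|) L with h2 | h2
    · rcases le_or_gt r ‖x‖ with h3 | h3
      · exact Or.inl (Or.inl (Or.inr ⟨⟨h1, h2⟩, h3⟩))
      · exact Or.inl (Or.inr ⟨⟨h1, h2⟩, by simpa using h3⟩)
    · exact Or.inr h2.le
  rw [← setLIntegral_univ]
  refine (lintegral_mono_set hcover).trans ((lintegral_union_le _ _ _).trans ?_)
  gcongr
  refine (lintegral_union_le _ _ _).trans ?_
  gcongr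
  exact lintegral_union_le _ _ _

/-- A bounded sequence of `X` converging weakly to zero tends to zero in `L^q_K`. -/
lemma tendsto_lintegral_of_weakConv_zero (hα : 0 < α) (hN : 2 * α < N) (hV : Continuous V)
    (h1 : H1 V K) (h2 : H2 K) (h3 : H3 V K) {q : ℝ} (hq : 2 < q) (hq' : q < critExp N α)
    {z : ℕ → EN N → ℝ} (hz : ∀ n, memX α V (z n)) {M : ℝ} (hM0 : 0 ≤ M)
    (hM : ∀ n, normSq α V (z n) ≤ ENNReal.ofReal M) (hconv : weakConv α V z 0) :
    Tendsto (fun n => ∫⁻ x, ENNReal.ofReal (K x * |z n x| ^ q)) atTop (nhds 0) := by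
  obtain ⟨hV0, hK0, C₁, hC₁⟩ := h1
  obtain ⟨C₃, hC₃⟩ := h3
  have hC₁0 : 0 < C₁ := (hK0 0).trans_le (hC₁ 0)
  have hC₃0 : 0 < C₃ := (div_pos (hK0 0) (hV0 0)).trans_le (hC₃ 0)
  have hKV : ∀ x, K x ≤ C₃ * V x := fun x => (div_le_iff₀ (hV0 x)).1 (hC₃ x)
  have hω := unitBallVol_pos (N := N)
  set p := critExp N α
  have hp0 : 0 < p := by linarith
  have hgag : ∀ n, gagSq N α (z n) ≤ ENNReal.ofReal M := fun n => le_self_add.trans (hM n)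
  have hpot : ∀ n, ∫⁻ x, ENNReal.ofReal (V x * z n x ^ 2) ≤ ENNReal.ofReal M := fun n =>
    le_add_self.trans (hM n)
  have hlocal : ∀ δ, 0 < δ → ∀ r, Tendsto (fun n => volume ({x | δ < |z n x|} ∩ ball 0 r))
      atTop (nhds 0) := fun δ hδ r =>
    tendsto_volume_superlevel_inter_ball hα (fun n => (hz n).1) hgag
      (fun n => integrableOn_ball_of_memX hV hV0 (hz n))
      (tendsto_integral_ball hV hV0 hz hM0 hM hconv) hδ r
  obtain ⟨B, hB, hweak⟩ := exists_weak_sobolev (N := N) hα hN hM0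
  have hB' : 0 < B * 2 ^ p := by positivity
  rw [ENNReal.tendsto_nhds_zero]
  intro ε hε
  obtain ⟨e, he0, heε⟩ : ∃ e : ℝ, 0 < e ∧ ENNReal.ofReal e ≤ ε := by
    obtain ⟨e, he0, he⟩ := ENNReal.lt_iff_exists_nnreal_btwn.1 hε
    exact ⟨e, by exact_mod_cast he0, by simpa using he.le⟩
  -- the thresholds separating small, intermediate and large values
  obtain ⟨δ, hδe, hδ0, hδ1⟩ : ∃ δ : ℝ, C₃ * δ ^ (q - 2) * M ≤ e / 4 ∧ 0 < δ ∧ δ ≤ 1 := by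
    have hlim : Tendsto (fun δ : ℝ => C₃ * δ ^ (q - 2) * M) (nhdsWithin 0 (Ioi 0)) (nhds 0) := by
      have h := (((Real.continuousAt_rpow_const 0 (q - 2)
        (Or.inr (by linarith))).tendsto.const_mul C₃).mul_const M)
      rw [Real.zero_rpow (by linarith), mul_zero, zero_mul] at h
      exact h.mono_left nhdsWithin_le_nhds
    have h := (hlim.eventually (ge_mem_nhds (by positivity : 0 < e / 4))).and
      (Ioc_mem_nhdsGT (one_pos : (0 : ℝ) < 1))
    obtain ⟨δ, h1, h2⟩ := h.exists
    exact ⟨δ, h1, h2.1, h2.2⟩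
  obtain ⟨L, hLe, hL1⟩ : ∃ L : ℝ,
      C₁ * (2 ^ q * (B * 2 ^ p) * (1 - 2 ^ (q - p))⁻¹ * L ^ (q - p)) ≤ e / 4 ∧ 1 ≤ L := by
    have hlim : Tendsto (fun L : ℝ =>
        C₁ * (2 ^ q * (B * 2 ^ p) * (1 - 2 ^ (q - p))⁻¹ * L ^ (q - p))) atTop (nhds 0) := by
      have h := ((tendsto_rpow_neg_atTop (y := p - q) (by linarith)).const_mul
        (2 ^ q * (B * 2 ^ p) * (1 - 2 ^ (q - p))⁻¹)).const_mul C₁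
      simpa using h
    exact ((hlim.eventually (ge_mem_nhds (by positivity : 0 < e / 4))).and
      (eventually_ge_atTop 1)).exists
  have hL0 : 0 < L := by linarith
  obtain ⟨r₀, hr₀, hweak⟩ := hweak (δ / 8) (by positivity)
  have hevent : ∀ᶠ n in atTop, volume ({x | δ / 8 < |z n x|} ∩ ball 0 r₀) ≤
      ENNReal.ofReal (unitBallVol N * r₀ ^ N / 2 ^ (N + 1)) :=
    (hlocal _ (by positivity) r₀).eventually (ge_mem_nhds (ENNReal.ofReal_pos.2 (by positivity)))
  obtain ⟨n₀, hn₀⟩ := eventually_atTop.1 hevent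
  have hlevel : ∀ n, n₀ ≤ n → ∀ s : ℝ, 0 < s →
      volume {x | 2 * (δ / 8) + s < |z n x|} ≤ ENNReal.ofReal (B * s ^ (-p)) := fun n hn =>
    hweak (z n) (hz n).1 (hgag n) (ENNReal.toReal_le_of_le_ofReal (by positivity) (hn₀ n hn))
  set A : ℕ → Set (EN N) := fun n => if n₀ ≤ n then {x | δ < |z n x|} else ∅ with hA
  obtain ⟨r, hr⟩ := h2 A (B * (δ / 2) ^ (-p)) (by positivity)
    (fun n => by
      by_cases hn : n₀ ≤ n
      · simpa [hA, hn] using measurableSet_superlevel (hz n).1 δ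
      · simp [hA, hn])
    (fun n => by
      by_cases hn : n₀ ≤ n
      · simp only [hA, hn, if_true]
        refine (measure_mono fun x hx => ?_).trans (hlevel n hn (δ / 2) (by positivity))
        have hx' : δ < |z n x| := hx
        simp only [mem_ofPred_eq]
        linarith
      · simp [hA, hn])
    (e / 4 / L ^ q) (by positivity)
  have hmid := (hlocal δ hδ0 r).eventually (ge_mem_nhds
    (ENNReal.ofReal_pos.2 (by positivity : 0 < e / 4 / (L ^ q * C₁))))
  filter_upwards [hmid, eventually_ge_atTop n₀] with n hn hnn
  have hzm := (hz n).1
  have hmS : MeasurableSet ({x | δ < |z n x|} ∩ {x | |z n x| ≤ L}) :=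
    (measurableSet_superlevel hzm δ).inter (measurableSet_le hzm.abs measurable_const)
  have I₁ := setLIntegral_small_le hV0 hK0 hC₃0 hKV hzm hq (hpot n) hδ0
  have I₂ : ∫⁻ x in ({x | δ < |z n x|} ∩ {x | |z n x| ≤ L}) ∩ {x | r ≤ ‖x‖},
      ENNReal.ofReal (K x * |z n x| ^ q) ≤ ENNReal.ofReal (e / 4) := by
    refine (setLIntegral_bounded_le (hmS.inter (measurableSet_le measurable_const measurable_norm))
      hK0 (by linarith) hL0 fun x hx => hx.1.2).trans ?_
    have h := hr r le_rfl n
    simp only [hA, hnn, if_true] at h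
    calc _ ≤ ENNReal.ofReal (L ^ q) * ENNReal.ofReal (e / 4 / L ^ q) := by
          gcongr
          refine (lintegral_mono_set ?_).trans h
          exact inter_subset_inter_left _ inter_subset_left
      _ = _ := by
          rw [← ENNReal.ofReal_mul (by positivity)]
          congr 1; field_simp
  have I₃ : ∫⁻ x in ({x | δ < |z n x|} ∩ {x | |z n x| ≤ L}) ∩ ball 0 r,
      ENNReal.ofReal (K x * |z n x| ^ q) ≤ ENNReal.ofReal (e / 4) := by
    refine (setLIntegral_bounded_le (hmS.inter measurableSet_ball)
      hK0 (by linarith) hL0 fun x hx => hx.1.2).trans ?_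
    calc _ ≤ ENNReal.ofReal (L ^ q) * ∫⁻ x in {x | δ < |z n x|} ∩ ball 0 r, ENNReal.ofReal C₁ := by
          refine mul_le_mul' le_rfl ?_
          refine (lintegral_mono fun x => ENNReal.ofReal_le_ofReal (hC₁ x)).trans
            (lintegral_mono_set ?_)
          exact inter_subset_inter_left _ inter_subset_left
      _ ≤ ENNReal.ofReal (L ^ q) * (ENNReal.ofReal C₁ *
          ENNReal.ofReal (e / 4 / (L ^ q * C₁))) := by
          rw [setLIntegral_const]
          gcongr
      _ = _ := by
          rw [← ENNReal.ofReal_mul (by positivity), ← ENNReal.ofReal_mul (by positivity)]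
          congr 1; field_simp
  have I₄ : ∫⁻ x in {x | L ≤ |z n x|}, ENNReal.ofReal (K x * |z n x| ^ q) ≤
      ENNReal.ofReal (e / 4) := by
    have htail := setLIntegral_rpow_tail_le hzm hB' (by linarith) hq' (fun t ht => ?_) hL1
    · calc _ ≤ ∫⁻ x in {x | L ≤ |z n x|}, ENNReal.ofReal C₁ * ENNReal.ofReal (|z n x| ^ q) := by
            refine lintegral_mono fun x => ?_
            rw [← ENNReal.ofReal_mul hC₁0.le]
            have := hC₁ x
            gcongr
        _ = ENNReal.ofReal C₁ * ∫⁻ x in {x | L ≤ |z n x|}, ENNReal.ofReal (|z n x| ^ q) :=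
            lintegral_const_mul' _ _ ENNReal.ofReal_ne_top
        _ ≤ _ := by
            grw [htail]
            rw [← ENNReal.ofReal_mul hC₁0.le]
            exact ENNReal.ofReal_le_ofReal hLe
    · refine (measure_mono fun x hx => ?_).trans ((hlevel n hnn (t / 2) (by linarith)).trans
        (le_of_eq ?_))
      · have hx' : t ≤ |z n x| := hx
        simp only [mem_ofPred_eq]
        linarith
      · rw [Real.div_rpow (by linarith) (by norm_num), Real.rpow_neg (by norm_num : (0 : ℝ) ≤ 2),
          div_inv_eq_mul]
        congr 1; ring
  refine (lintegral_le_of_levels (z n) _ δ L r).trans ?_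
  refine le_trans (add_le_add (add_le_add (add_le_add
    (I₁.trans (ENNReal.ofReal_le_ofReal hδe)) I₂) I₃) I₄) (le_trans (le_of_eq ?_) heε)
  rw [← ENNReal.ofReal_add (by positivity) (by positivity),
    ← ENNReal.ofReal_add (by positivity) (by positivity),
    ← ENNReal.ofReal_add (by positivity) (by positivity)]
  congr 1; ring

end ZeroMass

open ZeroMass
/-- Lemma 2.2, part 1: compact embedding of `X` into `L^q_K` under (h3). -/
theorem statement4 {N : ℕ} (α : ℝ) (hα : α ∈ Set.Ioo (0 : ℝ) 1) (hN : 2 * α < N)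
    (V K : EN N → ℝ) (hV : Continuous V) (hK : Continuous K)
    (h1 : H1 V K) (h2 : H2 K) (h3 : H3 V K)
    (q : ℝ) (hq : 2 < q) (hq' : q < critExp N α)
    (u : ℕ → EN N → ℝ) (hu : ∀ n, memX α V (u n))
    (hbdd : ∃ C : ℝ, ∀ n, Xnorm α V (u n) ≤ C)
    (w : EN N → ℝ) (hw : memX α V w) (hconv : weakConv α V u w) :
    Filter.Tendsto (fun n => ∫⁻ x, ENNReal.ofReal (K x * |u n x - w x| ^ q))
      Filter.atTop (nhds 0) := by
  obtain ⟨C, hC⟩ := hbdd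
  have hC0 : 0 ≤ C := le_trans (Real.rpow_nonneg ENNReal.toReal_nonneg _) (hC 0)
  have hV0 := h1.1
  have hbound : ∀ n, normSq α V (u n) ≤ ENNReal.ofReal (C ^ 2) := by
    intro n
    rw [← ENNReal.ofReal_toReal (hu n).2.ne]
    refine ENNReal.ofReal_le_ofReal ?_
    have h := hC n
    rw [Xnorm, ← Real.sqrt_eq_rpow] at h
    exact (Real.sqrt_le_left hC0).1 h
  have hsub : ∀ n, (fun x => u n x - w x) = u n + (-1 : ℝ) • w := by
    intro n
    ext x
    simp [sub_eq_add_neg]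
  have hw' := memX_smul (-1) hw
  have hz : ∀ n, memX α V (fun x => u n x - w x) := by
    intro n
    rw [hsub n]
    exact memX_add hV hV0 (hu n) hw'
  refine tendsto_lintegral_of_weakConv_zero hα.1 hN hV h1 h2 h3 hq hq' hz
    (M := 2 * C ^ 2 + 2 * (normSq α V w).toReal) (by positivity) (fun n => ?_) ?_
  · rw [hsub n, ENNReal.ofReal_add (by positivity) (by positivity),
      ENNReal.ofReal_mul (by norm_num), ENNReal.ofReal_mul (by norm_num),
      ENNReal.ofReal_toReal hw.2.ne, ENNReal.ofReal_ofNat]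
    refine (normSq_add_le hV hV0 (hu n).1 hw'.1).trans ?_
    rw [normSq_smul]
    have := hbound n
    simp only [even_two, Even.neg_pow, one_pow, ENNReal.ofReal_one, one_mul]
    gcongr
  · intro v hv
    simpa using hconv v hv
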